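/- (Smoothly growing assemblies converge) Suppose ã_k^{(j)} = a_j^k/k! with a_j > 0 for all j ≥ 1, and suppose a_j/a_{j+1} → ρ as j → ∞ for some ρ ∈ (0,∞). Then (c̃_n)_{n≥0} ∈ RT_ρ, and for every l ≥ 1 and every (k_1,…,k_l) ∈ ℕ^l, lim_{n→∞} P_n(k_1,…,k_l) = ∏_{j=1}^l e^{−a_j ρ^j} (a_j ρ^j)^{k_j}/k_j!, i.e., the small component counts converge to independent Poisson laws with parameters a_j ρ^j. -/

import Mathlib

open Finset Filter Topology

/-- The scaled partition function `c̃_n = ∑_{η ∈ Ω_n} ∏_{j=1}^n b_{k_j}^{(j)}` associated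
with scaled weights `b j k = ã_k^{(j)}` (so `c̃_0 = 1`). -/
noncomputable def ctilOf (b : ℕ → ℕ → ℝ) (n : ℕ) : ℝ :=
  ∑ P : Nat.Partition n, ∏ j ∈ Finset.Icc 1 n, b j (Multiset.count j P.parts)

/-- The tail sums `T̃^{(l)}_m`: the sum over partitions of `m` with all parts `> l` of
`∏_{j=l+1}^m ã_{k_j}^{(j)}` (so `T̃^{(l)}_0 = 1`). -/
noncomputable def TtilOf (b : ℕ → ℕ → ℝ) (l m : ℕ) : ℝ :=
  ∑ P : Nat.Partition m,
    if ∀ j ∈ P.parts, l < j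
    then ∏ j ∈ Finset.Icc (l + 1) m, b j (Multiset.count j P.parts) else 0

/-- The marginal probability `P_n(k_1,…,k_l) = (∏_{j=1}^l ã_{k_j}^{(j)}) T̃^{(l)}_{n-M_l}/c̃_n`
where `M_l = ∑_{j=1}^l j k_j`. -/
noncomputable def PformOf (b : ℕ → ℕ → ℝ) (l : ℕ) (k : Fin l → ℕ) (n : ℕ) : ℝ :=
  (∏ i : Fin l, b ((i : ℕ) + 1) (k i))
    * TtilOf b l (n - ∑ i : Fin l, ((i : ℕ) + 1) * k i) / ctilOf b n

/-- A sequence of nonnegative reals is in `RT_ρ` if `d_n/d_{n+1} → ρ`. -/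
def RT (d : ℕ → ℝ) (ρ : ℝ) : Prop :=
  Tendsto (fun n => d n / d (n + 1)) atTop (nhds ρ)

/-- Scaled weights of an assembly: `ã_k^{(j)} = a_j^k/k!` (Poisson case). -/
noncomputable def asmWt (aseq : ℕ → ℝ) (j k : ℕ) : ℝ :=
  aseq j ^ k / (Nat.factorial k : ℝ)

section

open PowerSeries

/-- The power series `exp (α X ^ j)`. -/
noncomputable def expMonomial (α : ℝ) (j : ℕ) (hj : j ≠ 0) : ℝ⟦X⟧ :=
  PowerSeries.expand j hj (PowerSeries.rescale α (PowerSeries.exp ℝ))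

theorem coeff_expMonomial (α : ℝ) (j : ℕ) (hj : j ≠ 0) (m : ℕ) :
    PowerSeries.coeff m (expMonomial α j hj) =
      if j ∣ m then α ^ (m / j) / (Nat.factorial (m / j) : ℝ) else 0 := by
  simp [expMonomial, PowerSeries.coeff_expand, PowerSeries.coeff_rescale,
    PowerSeries.coeff_exp, div_eq_mul_inv]

theorem coeff_mul_expMonomial (α : ℝ) (j : ℕ) (hj : j ≠ 0) (k : ℕ) :
    PowerSeries.coeff (j * k) (expMonomial α j hj) = α ^ k / (Nat.factorial k : ℝ) := by
  rw [coeff_expMonomial, if_pos (dvd_mul_right j k), Nat.mul_div_cancel_left _ (by omega)]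

theorem expMonomial_mul_neg (α : ℝ) (j : ℕ) (hj : j ≠ 0) :
    expMonomial α j hj * expMonomial (-α) j hj = 1 := by
  rw [expMonomial, expMonomial, ← map_mul, PowerSeries.exp_mul_exp_eq_exp_add]
  simp

theorem derivative_expMonomial (α : ℝ) (j : ℕ) :
    PowerSeries.derivative ℝ (expMonomial α (j + 1) j.succ_ne_zero) =
      expMonomial α (j + 1) j.succ_ne_zero * (PowerSeries.C (((j : ℝ) + 1) * α) * X ^ j) := by
  have h : PowerSeries.derivative ℝ (PowerSeries.rescale α (PowerSeries.exp ℝ)) =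
      α • PowerSeries.rescale α (PowerSeries.exp ℝ) := by
    ext n
    rw [PowerSeries.coeff_derivative, map_smul, PowerSeries.coeff_rescale,
      PowerSeries.coeff_rescale, PowerSeries.coeff_exp, PowerSeries.coeff_exp]
    simp only [Nat.factorial_succ, map_div₀, map_one, map_natCast, Nat.cast_mul, smul_eq_mul,
      Nat.cast_succ, map_mul, map_add]
    have := Nat.factorial_ne_zero n
    have : (n : ℝ) + 1 ≠ 0 := by positivity
    field_simp
    ring
  rw [expMonomial, PowerSeries.expand_apply,
    PowerSeries.derivative_subst (PowerSeries.HasSubst.X_pow j.succ_ne_zero), h,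
    ← PowerSeries.expand_apply _ j.succ_ne_zero, ← PowerSeries.expand_apply _ j.succ_ne_zero,
    map_smul, PowerSeries.derivative_pow, PowerSeries.smul_eq_C_mul]
  simp
  ring

theorem hasSum_expMonomial (α x : ℝ) (j : ℕ) (hj : j ≠ 0) :
    HasSum (fun m => PowerSeries.coeff m (expMonomial α j hj) * x ^ m) (Real.exp (α * x ^ j)) := by
  have hinj : Function.Injective (fun k => j * k) := fun a b h =>
    Nat.eq_of_mul_eq_mul_left (by omega) h
  rw [← hinj.hasSum_iff]
  · have h := NormedSpace.expSeries_div_hasSum_exp (α * x ^ j)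
    rw [← Real.exp_eq_exp_ℝ] at h
    refine h.congr_fun fun k => ?_
    simp only [Function.comp, coeff_mul_expMonomial]
    ring
  · intro m hm
    rw [coeff_expMonomial, if_neg, zero_mul]
    rintro ⟨k, rfl⟩
    exact hm ⟨k, rfl⟩

theorem summable_abs_expMonomial (α x : ℝ) (j : ℕ) (hj : j ≠ 0) :
    Summable (fun m => |PowerSeries.coeff m (expMonomial α j hj)| * x ^ m) := by
  refine (hasSum_expMonomial |α| x j hj).summable.congr fun m => ?_
  rw [coeff_expMonomial, coeff_expMonomial]
  split_ifs <;> simp [abs_div]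

theorem TtilOf_eq_sum_toFinsupp_prod (aseq : ℕ → ℝ) (l m : ℕ) :
    TtilOf (asmWt aseq) l m = ∑ P : Nat.Partition m,
      P.parts.toFinsupp.prod (fun i k => if l < i then asmWt aseq i k else 0) := by
  refine Finset.sum_congr rfl fun P _ => ?_
  simp only [Finsupp.prod, Multiset.toFinsupp_support, Multiset.toFinsupp_apply]
  split_ifs with h
  · refine (Finset.prod_subset_one_on_sdiff ?_ ?_ ?_).symm
    · intro i hi
      rw [Multiset.mem_toFinset] at hi
      exact Finset.mem_Icc.2 ⟨h i hi, P.le_of_mem_parts hi⟩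
    · intro i hi
      simp only [Finset.mem_sdiff, Multiset.mem_toFinset] at hi
      simp [asmWt, Multiset.count_eq_zero_of_notMem hi.2]
    · intro i hi
      rw [if_pos (h i (Multiset.mem_toFinset.1 hi))]
  · push Not at h
    obtain ⟨i, hi, hil⟩ := h
    exact (Finset.prod_eq_zero (Multiset.mem_toFinset.2 hi) (if_neg (by omega))).symm

/-- The generating function of the tail sums. -/
noncomputable def tailSeries (aseq : ℕ → ℝ) (l : ℕ) : ℝ⟦X⟧ :=
  PowerSeries.mk (TtilOf (asmWt aseq) l)

open scoped PowerSeries.WithPiTopology in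
theorem hasProd_tailSeries (aseq : ℕ → ℝ) (l : ℕ) :
    HasProd (fun i => if l ≤ i then expMonomial (aseq (i + 1)) (i + 1) i.succ_ne_zero else 1)
      (tailSeries aseq l) := by
  have hgen : tailSeries aseq l =
      Nat.Partition.genFun (fun i k => if l < i then asmWt aseq i k else 0) := by
    ext n
    rw [Nat.Partition.coeff_genFun, tailSeries, PowerSeries.coeff_mk, TtilOf_eq_sum_toFinsupp_prod]
  rw [hgen]
  refine (Nat.Partition.hasProd_genFun
    (fun i k => if l < i then asmWt aseq i k else 0)).congr_fun fun i => ?_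
  by_cases h : l ≤ i
  · have hs := Nat.Partition.summable_genFun_term (asmWt aseq) i
    simp only [if_pos h, if_pos (Nat.lt_succ_of_le h)]
    ext m
    rw [map_add, hs.map_tsum _ (PowerSeries.WithPiTopology.continuous_coeff _ _)]
    by_cases hm : i + 1 ∣ m
    · obtain ⟨k, rfl⟩ := hm
      rw [coeff_mul_expMonomial]
      rcases k with _ | k
      · simp [PowerSeries.coeff_X_pow]
      · rw [tsum_eq_single k]
        · simp [PowerSeries.coeff_X_pow, PowerSeries.coeff_one, asmWt]
        · intro b hb
          simp [PowerSeries.coeff_X_pow, Ne.symm hb]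
    · rw [coeff_expMonomial, if_neg hm, PowerSeries.coeff_one, if_neg (by rintro rfl; simp at hm)]
      symm
      rw [zero_add]
      convert tsum_zero with b
      rw [map_smul, PowerSeries.coeff_X_pow, if_neg (by rintro rfl; simp at hm), smul_zero]
  · have h' : ¬ l < i + 1 := by omega
    simp [h, h']

open scoped PowerSeries.WithPiTopology in
theorem tailSeries_eq_mul (aseq : ℕ → ℝ) (l : ℕ) :
    tailSeries aseq l = tailSeries aseq (l + 1) *
      expMonomial (aseq (l + 1)) (l + 1) l.succ_ne_zero := by
  refine (hasProd_tailSeries aseq l).unique ?_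
  convert (hasProd_tailSeries aseq (l + 1)).mul
    (hasProd_ite_eq l (expMonomial (aseq (l + 1)) (l + 1) l.succ_ne_zero)) using 2 with i
  rcases lt_trichotomy i l with h | rfl | h
  · simp [h.ne, h.not_ge, show ¬ l + 1 ≤ i by omega]
  · simp
  · simp [h.ne', h.le, show l + 1 ≤ i by omega]

theorem tailSeries_succ (aseq : ℕ → ℝ) (l : ℕ) :
    tailSeries aseq (l + 1) = tailSeries aseq l *
      expMonomial (-aseq (l + 1)) (l + 1) l.succ_ne_zero := by
  rw [tailSeries_eq_mul aseq l, mul_assoc, expMonomial_mul_neg, mul_one]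

theorem TtilOf_eq_zero (b : ℕ → ℕ → ℝ) {l m : ℕ} (hm : m ≠ 0) (hml : m ≤ l) :
    TtilOf b l m = 0 := by
  refine Finset.sum_eq_zero fun P _ => if_neg fun h => ?_
  obtain ⟨i, hi⟩ : ∃ i, i ∈ P.parts := by
    refine Multiset.exists_mem_of_ne_zero fun h0 => hm ?_
    rw [← P.parts_sum, h0, Multiset.sum_zero]
  have := h i hi
  have := P.le_of_mem_parts hi
  omega

theorem ctilOf_eq_TtilOf (b : ℕ → ℕ → ℝ) (n : ℕ) : ctilOf b n = TtilOf b 0 n := by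
  refine Finset.sum_congr rfl fun P _ => ?_
  rw [if_pos fun j hj => P.parts_pos hj]

theorem exists_derivative_tailSeries (aseq : ℕ → ℝ) (N : ℕ) :
    ∃ G : ℝ⟦X⟧, tailSeries aseq 0 = tailSeries aseq N * G ∧
      PowerSeries.derivative ℝ (tailSeries aseq 0) =
        tailSeries aseq 0 * ∑ j ∈ Finset.range N, PowerSeries.C (((j : ℝ) + 1) * aseq (j + 1)) * X ^ j
          + PowerSeries.derivative ℝ (tailSeries aseq N) * G := by
  induction N with
  | zero => exact ⟨1, by simp, by simp⟩
  | succ N ih =>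
    obtain ⟨G, h1, h2⟩ := ih
    have h3 := tailSeries_eq_mul aseq N
    refine ⟨expMonomial (aseq (N + 1)) (N + 1) N.succ_ne_zero * G, ?_, ?_⟩
    · rw [← mul_assoc, ← h3, h1]
    · have h4 : tailSeries aseq 0 = tailSeries aseq (N + 1) *
        expMonomial (aseq (N + 1)) (N + 1) N.succ_ne_zero * G := by rw [← h3, h1]
      rw [h2, h3, Finset.sum_range_succ, mul_add, Derivation.leibniz, derivative_expMonomial,
        smul_eq_mul, smul_eq_mul]
      linear_combination (-(PowerSeries.C (((N : ℝ) + 1) * aseq (N + 1)) * X ^ N)) * h4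

theorem ctilOf_recurrence (aseq : ℕ → ℝ) (n : ℕ) :
    ((n : ℝ) + 1) * ctilOf (asmWt aseq) (n + 1) = ∑ i ∈ Finset.range (n + 1),
      (((i : ℝ) + 1) * aseq (i + 1)) * ctilOf (asmWt aseq) (n - i) := by
  obtain ⟨G, -, h⟩ := exists_derivative_tailSeries aseq (n + 1)
  have hz : PowerSeries.coeff n (PowerSeries.derivative ℝ (tailSeries aseq (n + 1)) * G) = 0 := by
    rw [PowerSeries.coeff_mul]
    refine Finset.sum_eq_zero fun p hp => ?_
    have := Finset.HasAntidiagonal.mem_antidiagonal.1 hp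
    rw [PowerSeries.coeff_derivative, tailSeries, PowerSeries.coeff_mk,
      TtilOf_eq_zero _ (by omega) (by omega), zero_mul, zero_mul]
  have h' := congrArg (PowerSeries.coeff n) h
  rw [map_add, hz, add_zero, PowerSeries.coeff_derivative, Finset.mul_sum, map_sum, tailSeries,
    PowerSeries.coeff_mk, ← ctilOf_eq_TtilOf, mul_comm] at h'
  rw [h']
  refine Finset.sum_congr rfl fun i hi => ?_
  have hi' : i ≤ n := by simpa [Nat.lt_succ_iff] using hi
  rw [mul_left_comm, PowerSeries.coeff_C_mul, PowerSeries.coeff_mul_X_pow', if_pos hi',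
    PowerSeries.coeff_mk, ← ctilOf_eq_TtilOf]

theorem ctilOf_pos (aseq : ℕ → ℝ) (ha : ∀ j, 1 ≤ j → 0 < aseq j) (n : ℕ) :
    0 < ctilOf (asmWt aseq) n := by
  refine Finset.sum_pos (fun P _ => Finset.prod_pos fun j hj => ?_) Finset.univ_nonempty
  have := ha j (Finset.mem_Icc.1 hj).1
  unfold asmWt
  positivity

theorem sub_le_pow_mul {c : ℕ → ℝ} {K : ℝ} (hK : 0 ≤ K) (h : ∀ n, c n ≤ K * c (n + 1))
    {m n : ℕ} (hmn : m ≤ n) : c (n - m) ≤ K ^ m * c n := by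
  obtain ⟨p, rfl⟩ := Nat.exists_eq_add_of_le' hmn
  rw [Nat.add_sub_cancel]
  clear hmn
  induction m with
  | zero => simp
  | succ m ih =>
    calc c p ≤ K ^ m * c (p + m) := ih
      _ ≤ K ^ m * (K * c (p + m + 1)) := by gcongr; exact h _
      _ = K ^ (m + 1) * c (p + (m + 1)) := by rw [← add_assoc]; ring

section Recurrence

variable {c d : ℕ → ℝ} {ρ : ℝ}

theorem exists_le_mul_succ_of_recurrence (hc : ∀ n, 0 < c n) (hd : ∀ n, 0 < d n)
    (hlim : Tendsto (fun n => d n / d (n + 1)) atTop (𝓝 ρ))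
    (hrec : ∀ n : ℕ, ((n : ℝ) + 1) * c (n + 1) = ∑ i ∈ Finset.range (n + 1), d i * c (n - i)) :
    ∃ K, 0 ≤ K ∧ ∀ n, c n ≤ K * c (n + 1) := by
  obtain ⟨B, hB⟩ := hlim.bddAbove_range
  have hB' : ∀ i, d i ≤ B * d (i + 1) := fun i =>
    (div_le_iff₀ (hd _)).1 (hB ⟨i, rfl⟩)
  have hB0 : 0 < B := (div_pos (hd 0) (hd 1)).trans_le (hB ⟨0, rfl⟩)
  refine ⟨2 * B + c 0 / c 1, by have := hc 0; have := hc 1; positivity, fun n => ?_⟩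
  have h01 : 0 ≤ c 0 / c 1 := (div_pos (hc 0) (hc 1)).le
  rcases n with _ | n
  · have h1 := div_mul_cancel₀ (c 0) (hc 1).ne'
    have := mul_pos hB0 (hc 1)
    rw [zero_add, add_mul, h1]
    linarith
  · have h1 := hrec (n + 1)
    rw [Finset.sum_range_succ'] at h1
    have h2 : ((n : ℝ) + 1) * c (n + 1) ≤
        B * ∑ i ∈ Finset.range (n + 1), d (i + 1) * c (n + 1 - (i + 1)) := by
      rw [hrec, Finset.mul_sum]
      refine Finset.sum_le_sum fun i _ => ?_
      rw [Nat.add_sub_add_right, ← mul_assoc]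
      exact mul_le_mul_of_nonneg_right (hB' i) (hc _).le
    have h3 : 0 < d 0 * c (n + 1 - 0) := mul_pos (hd 0) (hc _)
    simp only [Nat.add_sub_add_right, Nat.sub_zero] at h1 h2 h3
    push_cast at h1
    have h4 : ((n : ℝ) + 1) * c (n + 1) ≤ B * (((n : ℝ) + 1 + 1) * c (n + 1 + 1)) := by
      refine h2.trans (mul_le_mul_of_nonneg_left ?_ hB0.le)
      linarith
    have h5 := mul_pos hB0 (hc (n + 1 + 1))
    have hn : (0 : ℝ) ≤ n := n.cast_nonneg
    have h6 : ((n : ℝ) + 1) * c (n + 1) ≤ (n + 1) * (2 * B * c (n + 1 + 1)) := by nlinarith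
    have h7 := le_of_mul_le_mul_left h6 (by positivity)
    have h8 := mul_nonneg h01 (hc (n + 1 + 1)).le
    linarith

theorem exists_abs_sub_le_of_recurrence (hρ : 0 < ρ) (hc : ∀ n, 0 < c n) (hd : ∀ n, 0 < d n)
    (hlim : Tendsto (fun n => d n / d (n + 1)) atTop (𝓝 ρ))
    (hrec : ∀ n : ℕ, ((n : ℝ) + 1) * c (n + 1) = ∑ i ∈ Finset.range (n + 1), d i * c (n - i))
    {ε : ℝ} (hε : 0 < ε) :
    ∃ C, ∀ n : ℕ, |ρ * (((n : ℝ) + 2) * c (n + 2)) - ((n : ℝ) + 1) * c (n + 1)| ≤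
      (ε * ((n : ℝ) + 1) + C) * c (n + 1) := by
  obtain ⟨K, hK, hcK⟩ := exists_le_mul_succ_of_recurrence hc hd hlim hrec
  have hinv : Tendsto (fun n => ρ * (d n / d (n + 1))⁻¹) atTop (𝓝 1) := by
    simpa [hρ.ne'] using (hlim.inv₀ hρ.ne').const_mul ρ
  obtain ⟨J, hJ⟩ := Metric.tendsto_atTop.1 hinv ε hε
  set m : ℕ → ℝ := fun i => |ρ * d (i + 1) - d i|
  have hm : ∀ i, m i ≤ ε * d i + if i < J then m i else 0 := by
    intro i
    split_ifs with h
    · have := mul_pos hε (hd i)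
      linarith
    · have h1 := (hJ i (not_lt.1 h)).le
      rw [Real.dist_eq, inv_div] at h1
      have h2 : ρ * d (i + 1) - d i = (ρ * (d (i + 1) / d i) - 1) * d i := by
        have := (hd i).ne'
        field_simp
      simp only [m, h2, abs_mul, abs_of_pos (hd i), add_zero]
      exact mul_le_mul_of_nonneg_right h1 (hd i).le
  refine ⟨ρ * d 0 + ∑ i ∈ Finset.range J, m i * K ^ (i + 1), fun n => ?_⟩
  have h1 := hrec (n + 1)
  rw [Finset.sum_range_succ'] at h1
  push_cast at h1
  have h2 : ρ * (((n : ℝ) + 2) * c (n + 2)) - ((n : ℝ) + 1) * c (n + 1) =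
      ρ * d 0 * c (n + 1) +
        ∑ i ∈ Finset.range (n + 1), (ρ * d (i + 1) - d i) * c (n - i) := by
    have h3 : ((n : ℝ) + 2) * c (n + 2) = ((n : ℝ) + 1 + 1) * c (n + 1 + 1) := by ring_nf
    rw [h3, h1, hrec n]
    simp only [sub_mul, Finset.sum_sub_distrib, mul_add, Finset.mul_sum]
    simp only [mul_assoc]
    ring
  have h4 : ∑ i ∈ Finset.range (n + 1), (if i < J then m i else 0) * c (n - i) ≤
      (∑ i ∈ Finset.range J, m i * K ^ (i + 1)) * c (n + 1) := by
    have h5 : ∀ i ∈ Finset.range (n + 1), (if i < J then m i else 0) * c (n - i) ≤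
        (if i < J then m i * K ^ (i + 1) else 0) * c (n + 1) := by
      intro i hi
      have hi' : i + 1 ≤ n + 1 := by simpa using hi
      split_ifs
      · rw [mul_assoc, ← Nat.add_sub_add_right n 1 i]
        exact mul_le_mul_of_nonneg_left (sub_le_pow_mul hK hcK hi') (abs_nonneg _)
      · simp
    refine (Finset.sum_le_sum h5).trans ?_
    rw [← Finset.sum_mul, ← Finset.sum_filter]
    refine mul_le_mul_of_nonneg_right (Finset.sum_le_sum_of_subset_of_nonneg ?_ ?_) (hc _).le
    · intro i hi
      exact Finset.mem_range.2 (Finset.mem_filter.1 hi).2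
    · intro i _ _
      positivity
  rw [h2]
  calc _ ≤ |ρ * d 0 * c (n + 1)| +
        ∑ i ∈ Finset.range (n + 1), |(ρ * d (i + 1) - d i) * c (n - i)| :=
        (abs_add_le _ _).trans (add_le_add_right (Finset.abs_sum_le_sum_abs _ _) _)
    _ ≤ ρ * d 0 * c (n + 1) + ∑ i ∈ Finset.range (n + 1),
        (ε * (d i * c (n - i)) + (if i < J then m i else 0) * c (n - i)) := by
      refine add_le_add (abs_of_pos (mul_pos (mul_pos hρ (hd 0)) (hc _))).le
        (Finset.sum_le_sum fun i _ => ?_)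
      rw [abs_mul, abs_of_pos (hc (n - i)), ← mul_assoc, ← add_mul]
      exact mul_le_mul_of_nonneg_right (hm i) (hc _).le
    _ ≤ _ := by
      rw [Finset.sum_add_distrib, ← Finset.mul_sum, ← hrec]
      linarith

theorem tendsto_div_succ_of_recurrence (hρ : 0 < ρ) (hc : ∀ n, 0 < c n) (hd : ∀ n, 0 < d n)
    (hlim : Tendsto (fun n => d n / d (n + 1)) atTop (𝓝 ρ))
    (hrec : ∀ n : ℕ, ((n : ℝ) + 1) * c (n + 1) = ∑ i ∈ Finset.range (n + 1), d i * c (n - i)) :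
    Tendsto (fun n => c n / c (n + 1)) atTop (𝓝 ρ) := by
  have hr : Tendsto (fun n : ℕ => ρ * (((n : ℝ) + 2) * c (n + 2)) / (((n : ℝ) + 1) * c (n + 1)))
      atTop (𝓝 1) := by
    rw [Metric.tendsto_atTop]
    intro ε hε
    obtain ⟨C, hC⟩ := exists_abs_sub_le_of_recurrence hρ hc hd hlim hrec (half_pos hε)
    obtain ⟨N, hN⟩ := exists_nat_gt (C / (ε / 2))
    refine ⟨N, fun n hn => ?_⟩
    have hpos : 0 < ((n : ℝ) + 1) * c (n + 1) := mul_pos (by positivity) (hc _)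
    rw [Real.dist_eq, div_sub_one hpos.ne', abs_div, abs_of_pos hpos, div_lt_iff₀ hpos,
      ← mul_assoc ε]
    refine (hC n).trans_lt (mul_lt_mul_of_pos_right ?_ (hc _))
    have h1 := (div_lt_iff₀ (half_pos hε)).1 hN
    have h2 : (N : ℝ) ≤ n := by exact_mod_cast hn
    nlinarith
  have hn : Tendsto (fun n : ℕ => 1 + 1 / ((n : ℝ) + 1)) atTop (𝓝 (1 + 0)) :=
    tendsto_one_div_add_atTop_nhds_zero_nat.const_add 1
  have := (hn.const_mul ρ).div hr one_ne_zero
  rw [← tendsto_add_atTop_iff_nat 1]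
  convert this using 2 with n
  · have h1 := (hc (n + 1)).ne'
    have h2 := (hc (n + 2)).ne'
    simp only [Pi.div_apply, add_assoc, one_add_one_eq_two]
    field_simp
    ring
  · simp

end Recurrence

section Tannery

variable {c : ℕ → ℝ} {ρ : ℝ}

theorem tendsto_sub_div (hc : ∀ n, 0 < c n)
    (hlim : Tendsto (fun n => c n / c (n + 1)) atTop (𝓝 ρ)) (m : ℕ) :
    Tendsto (fun n => c (n - m) / c n) atTop (𝓝 (ρ ^ m)) := by
  rw [← tendsto_add_atTop_iff_nat m]
  simp only [Nat.add_sub_cancel]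
  induction m with
  | zero => simp [div_self (hc _).ne']
  | succ m ih =>
    rw [pow_succ]
    refine (ih.mul (hlim.comp (tendsto_add_atTop_nat m))).congr fun n => ?_
    simp only [Function.comp, ← add_assoc]
    exact div_mul_div_cancel₀ (hc _).ne'

theorem tendsto_shift_div {T : ℕ → ℝ} {L : ℝ} (hc : ∀ n, 0 < c n)
    (hlim : Tendsto (fun n => c n / c (n + 1)) atTop (𝓝 ρ))
    (hT : Tendsto (fun n => T n / c n) atTop (𝓝 L)) (m : ℕ) :
    Tendsto (fun n => T (n - m) / c n) atTop (𝓝 (L * ρ ^ m)) := by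
  refine ((hT.comp (tendsto_sub_atTop_nat m)).mul (tendsto_sub_div hc hlim m)).congr fun n => ?_
  exact div_mul_div_cancel₀ (hc _).ne'

theorem tendsto_coeff_mul_div {T : ℕ → ℝ} {L K : ℝ} {e : ℝ⟦X⟧} (hc : ∀ n, 0 < c n)
    (hK : 0 ≤ K) (hcK : ∀ n, c n ≤ K * c (n + 1))
    (hlim : Tendsto (fun n => c n / c (n + 1)) atTop (𝓝 ρ))
    (hT : Tendsto (fun n => T n / c n) atTop (𝓝 L))
    (he : Summable fun m => |PowerSeries.coeff m e| * K ^ m) :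
    Tendsto (fun n => PowerSeries.coeff n (PowerSeries.mk T * e) / c n) atTop
      (𝓝 (L * ∑' m, PowerSeries.coeff m e * ρ ^ m)) := by
  obtain ⟨B, hB⟩ := hT.abs.bddAbove_range
  have hB' : ∀ n, |T n| ≤ B * c n := fun n => by
    have h : |T n / c n| ≤ B := hB ⟨n, rfl⟩
    rwa [abs_div, abs_of_pos (hc n), div_le_iff₀ (hc n)] at h
  have hB0 : 0 ≤ B := (abs_nonneg _).trans (hB ⟨0, rfl⟩)
  have key : Tendsto (fun n => ∑' m, if m ≤ n then PowerSeries.coeff m e * (T (n - m) / c n) else 0)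
      atTop (𝓝 (∑' m, PowerSeries.coeff m e * (L * ρ ^ m))) := by
    refine tendsto_tsum_of_dominated_convergence (he.mul_left B) (fun m => ?_)
      (Eventually.of_forall fun n m => ?_)
    · refine ((tendsto_shift_div hc hlim hT m).const_mul (PowerSeries.coeff m e)).congr' ?_
      filter_upwards [eventually_ge_atTop m] with n hn
      rw [if_pos hn]
    · split_ifs with h
      · rw [Real.norm_eq_abs, abs_mul, abs_div, abs_of_pos (hc n), mul_left_comm]
        refine mul_le_mul_of_nonneg_left ?_ (abs_nonneg _)
        rw [div_le_iff₀ (hc n), mul_assoc]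
        exact (hB' _).trans (mul_le_mul_of_nonneg_left (sub_le_pow_mul hK hcK h) hB0)
      · rw [norm_zero]
        positivity
  have hval : ∑' m, PowerSeries.coeff m e * (L * ρ ^ m) =
      L * ∑' m, PowerSeries.coeff m e * ρ ^ m := by
    rw [← tsum_mul_left]
    exact tsum_congr fun m => by ring
  rw [hval] at key
  refine key.congr fun n => ?_
  rw [tsum_eq_sum (s := Finset.range (n + 1)) fun m hm => if_neg (by simpa using hm), mul_comm,
    PowerSeries.coeff_mul, Finset.Nat.sum_antidiagonal_eq_sum_range_succ_mk, Finset.sum_div]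
  refine Finset.sum_congr rfl fun m hm => ?_
  rw [if_pos (by simpa [Nat.lt_succ_iff] using hm), PowerSeries.coeff_mk, mul_div_assoc]

end Tannery

theorem tendsto_TtilOf_div_ctilOf {aseq : ℕ → ℝ} {ρ K : ℝ}
    (hc : ∀ n, 0 < ctilOf (asmWt aseq) n) (hK : 0 ≤ K)
    (hcK : ∀ n, ctilOf (asmWt aseq) n ≤ K * ctilOf (asmWt aseq) (n + 1))
    (hlim : RT (ctilOf (asmWt aseq)) ρ) (l : ℕ) :
    Tendsto (fun n => TtilOf (asmWt aseq) l n / ctilOf (asmWt aseq) n) atTop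
      (𝓝 (∏ i ∈ Finset.range l, Real.exp (-(aseq (i + 1) * ρ ^ (i + 1))))) := by
  induction l with
  | zero => simp [← ctilOf_eq_TtilOf, div_self (hc _).ne']
  | succ l ih =>
    have h := tendsto_coeff_mul_div hc hK hcK hlim ih
      (summable_abs_expMonomial (-aseq (l + 1)) K (l + 1) l.succ_ne_zero)
    rw [(hasSum_expMonomial _ _ _ _).tsum_eq, neg_mul] at h
    rw [Finset.prod_range_succ]
    refine h.congr fun n => ?_
    rw [← tailSeries, ← tailSeries_succ, tailSeries, PowerSeries.coeff_mk]

end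

/-- **Smoothly growing assemblies converge.** If `ã_k^{(j)} = a_j^k/k!` with `a_j > 0`
and `a_j/a_{j+1} → ρ` for some `ρ ∈ (0,∞)`, then `(c̃_n) ∈ RT_ρ` and for every `l ≥ 1`
and every `(k_1,…,k_l) ∈ ℕ^l`,
`lim P_n(k_1,…,k_l) = ∏_{j=1}^l e^{−a_j ρ^j}(a_j ρ^j)^{k_j}/k_j!`, i.e. the small
component counts converge to independent Poisson laws with parameters `a_j ρ^j`. -/
theorem stmt12 (aseq : ℕ → ℝ) (ha : ∀ j, 1 ≤ j → 0 < aseq j)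
    (ρ : ℝ) (hρ : 0 < ρ)
    (hsm : Tendsto (fun j => aseq j / aseq (j + 1)) atTop (nhds ρ)) :
    RT (ctilOf (asmWt aseq)) ρ ∧
    ∀ l, 1 ≤ l → ∀ k : Fin l → ℕ,
      Tendsto (fun n => PformOf (asmWt aseq) l k n) atTop
        (nhds (∏ i : Fin l,
          Real.exp (-(aseq ((i : ℕ) + 1) * ρ ^ ((i : ℕ) + 1)))
            * (aseq ((i : ℕ) + 1) * ρ ^ ((i : ℕ) + 1)) ^ (k i)
            / (Nat.factorial (k i) : ℝ))) := by
  set d : ℕ → ℝ := fun i => ((i : ℝ) + 1) * aseq (i + 1)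
  have hd : ∀ n, 0 < d n := fun n => mul_pos (by positivity) (ha _ (by omega))
  have hc := ctilOf_pos aseq ha
  have hdlim : Tendsto (fun n => d n / d (n + 1)) atTop (𝓝 ρ) := by
    have h := (tendsto_natCast_div_add_atTop (1 : ℝ)).mul hsm
    rw [one_mul] at h
    refine (h.comp (tendsto_add_atTop_nat 1)).congr fun n => ?_
    simp only [Function.comp, d]
    push_cast
    rw [div_mul_div_comm]
  have hrec := ctilOf_recurrence aseq
  have hRT : RT (ctilOf (asmWt aseq)) ρ := tendsto_div_succ_of_recurrence hρ hc hd hdlim hrec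
  obtain ⟨K, hK, hcK⟩ := exists_le_mul_succ_of_recurrence hc hd hdlim hrec
  refine ⟨hRT, fun l _ k => ?_⟩
  have h := (tendsto_shift_div hc hRT (tendsto_TtilOf_div_ctilOf hc hK hcK hRT l)
    (∑ i : Fin l, ((i : ℕ) + 1) * k i)).const_mul (∏ i : Fin l, asmWt aseq ((i : ℕ) + 1) (k i))
  convert h using 2 with n
  · rw [PformOf, mul_div_assoc]
  · rw [← Finset.prod_pow_eq_pow_sum,
      ← Fin.prod_univ_eq_prod_range (fun i => Real.exp (-(aseq (i + 1) * ρ ^ (i + 1)))),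
      ← Finset.prod_mul_distrib, ← Finset.prod_mul_distrib]
    refine Finset.prod_congr rfl fun i _ => ?_
    rw [asmWt, mul_pow, ← pow_mul]
    ring
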